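/- For every tuple c = (c₁,…,c_n) of nonnegative integers, every word w ∈ W_c, and every positive integer k, one has slow^k(w) = ψ_c(s^k(φ^asc_c(w))), where slow^k and s^k denote k-fold composition. -/

import Mathlib

lemma foldr_max_mem {w : List ℕ} (h : w ≠ []) : w.foldr max 0 ∈ w := by
  induction w with
  | nil => exact absurd rfl h
  | cons a l ih =>
    rcases eq_or_ne l [] with rfl | hl
    · simp
    · have hm := ih hl
      simp only [List.foldr_cons]
      rcases max_choice a (l.foldr max 0) with h' | h' <;> rw [h']
      · exact List.mem_cons_self
      · exact List.mem_cons_of_mem _ hm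

lemma headI_mem {α : Type*} [Inhabited α] {l : List α} (h : l ≠ []) : l.headI ∈ l := by
  cases l with
  | nil => exact absurd rfl h
  | cons a t => simp

/-- `blocks n w` is the list of maximal (possibly empty) blocks of `w`
separated by occurrences of the letter `n`; that is, if `n` occurs `k` times
in `w`, then `blocks n w = [A₁, A₂, …, A_{k+1}]` where `w = A₁ n A₂ n ⋯ n A_{k+1}`
and no `Aᵢ` contains the letter `n`. -/
def blocks (n : ℕ) : List ℕ → List (List ℕ)
  | [] => [[]]
  | a :: l =>
    if a = n then [] :: blocks n l
    else (a :: (blocks n l).headI) :: (blocks n l).tail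

lemma blocks_ne_nil (n : ℕ) (w : List ℕ) : blocks n w ≠ [] := by
  cases w with
  | nil => simp [blocks]
  | cons a l =>
    simp only [blocks]
    split <;> simp

lemma blocks_length {n : ℕ} {w : List ℕ} : ∀ {A : List ℕ}, A ∈ blocks n w →
    A.length + w.count n ≤ w.length := by
  induction w with
  | nil =>
    intro A hA
    simp only [blocks, List.mem_singleton] at hA
    subst hA; simp
  | cons a l ih =>
    intro A hA
    by_cases h : a = n
    · subst h
      simp only [blocks, if_pos rfl] at hA
      have hcc : (a :: l).count a = l.count a + 1 := by simp
      cases hA with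
      | head =>
        have := List.count_le_length (a := a) (l := l)
        simp only [List.length_nil, List.length_cons, hcc]
        omega
      | tail _ h1 =>
        have := ih h1
        simp only [List.length_cons, hcc]
        omega
    · simp only [blocks, if_neg h] at hA
      have hcc : (a :: l).count n = l.count n := by
        simp [List.count_cons, h]
      cases hA with
      | head =>
        have := ih (headI_mem (blocks_ne_nil n l))
        simp only [List.length_cons, hcc]
        omega
      | tail _ h1 =>
        have := ih (List.mem_of_mem_tail h1)
        simp only [List.length_cons, hcc]
        omega

/-- The generalized stack-sorting map `slow` (the convention in which a letter may
not sit on top of a copy of itself in the stack): `slow ε = ε`, and if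
`w = A₁ n A₂ n ⋯ n A_{k+1}` where `n` is the largest letter of `w` (occurring
`k` times) and the `Aᵢ` contain only letters smaller than `n`, then
`slow w = slow A₁ ++ slow A₂ ++ [n] ++ slow A₃ ++ [n] ++ ⋯ ++ slow A_{k+1} ++ [n]`. -/
def slow (w : List ℕ) : List ℕ :=
  if h : w = [] then []
  else
    (have : (blocks (w.foldr max 0) w).headI.length < w.length := by
      have h1 := blocks_length (headI_mem (blocks_ne_nil (w.foldr max 0) w))
      have h2 : 0 < w.count (w.foldr max 0) :=
        List.count_pos_iff.mpr (foldr_max_mem h)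
      omega
     slow (blocks (w.foldr max 0) w).headI) ++
    ((blocks (w.foldr max 0) w).tail.attach.map
      fun (A : {x // x ∈ (blocks (w.foldr max 0) w).tail}) =>
      have : A.1.length < w.length := by
        have h1 := blocks_length (List.mem_of_mem_tail A.2)
        have h2 : 0 < w.count (w.foldr max 0) :=
          List.count_pos_iff.mpr (foldr_max_mem h)
        omega
      slow A.1 ++ [w.foldr max 0]).flatten
termination_by w.length

/-- Membership in `W_c`: `w` is a word over the positive integers with exactly
`cᵢ` copies of the letter `i` for each `1 ≤ i ≤ n = c.length` (and no other letters). -/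
def InW (c : List ℕ) (w : List ℕ) : Prop :=
  0 ∉ w ∧ ∀ i : ℕ, w.count (i + 1) = c.getD i 0

/-- The identity word `Id_c = 1^{c₁} 2^{c₂} ⋯ n^{c_n}`, the unique word in `W_c`
whose letters are nondecreasing from left to right. -/
def idWord (c : List ℕ) : List ℕ :=
  ((List.range c.length).map fun i => List.replicate (c.getD i 0) (i + 1)).flatten

/-- West's stack-sorting map `s`, defined recursively by `s ε = ε` and
`s (L n R) = s L ++ s R ++ [n]`, where `n` is the largest entry of the
permutation and `L`, `R` are the substrings to its left and right. -/
def westS (w : List ℕ) : List ℕ :=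
  if h : w = [] then []
  else
    have hi : w.idxOf (w.foldr max 0) < w.length :=
      List.idxOf_lt_length_iff.mpr (foldr_max_mem h)
    westS (w.take (w.idxOf (w.foldr max 0))) ++
      westS (w.drop (w.idxOf (w.foldr max 0) + 1)) ++ [w.foldr max 0]
termination_by w.length
decreasing_by
  · simp only [List.length_take, List.foldr_attach (f := max)]; omega
  · simp only [List.length_drop]; omega

/-- The letter-replacement map underlying `ψ_c`: the value `v` (with
`p_i + 1 ≤ v ≤ p_i + c_i`, where `p_i = c₁ + ⋯ + c_{i-1}`) is sent to the letter `i`. -/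
def psiLetter : List ℕ → ℕ → ℕ
  | [], _ => 0
  | a :: rest, v => if v ≤ a then 1 else psiLetter rest (v - a) + 1

/-- `ψ_c : S_{c₁+⋯+c_n} → W_c` replaces each of the entries `p_i+1, …, p_i+c_i`
by the letter `i`, where `p_i = c₁ + ⋯ + c_{i-1}`. -/
def psiMap (c : List ℕ) (π : List ℕ) : List ℕ := π.map (psiLetter c)

/-- `φ^asc_c : W_c → S_{c₁+⋯+c_n}` replaces the `cᵢ` copies of the letter `i`
(from left to right) by the integers `p_i+1, p_i+2, …, p_i+c_i` in ascending order,
where `p_i = c₁ + ⋯ + c_{i-1}`. -/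
def phiAsc (c : List ℕ) (w : List ℕ) : List ℕ :=
  (List.range w.length).map fun t =>
    (c.take (w.getD t 0 - 1)).sum + (w.take (t + 1)).count (w.getD t 0)

/-- `φ^des_c : W_c → S_{c₁+⋯+c_n}` replaces the `cᵢ` copies of the letter `i`
(from left to right) by the integers `p_i+1, p_i+2, …, p_i+c_i` in descending order,
where `p_i = c₁ + ⋯ + c_{i-1}`. -/
def phiDes (c : List ℕ) (w : List ℕ) : List ℕ :=
  (List.range w.length).map fun t =>
    (c.take (w.getD t 0)).sum + 1 - (w.take (t + 1)).count (w.getD t 0)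

lemma le_foldr_max {w : List ℕ} {x : ℕ} (hx : x ∈ w) : x ≤ w.foldr max 0 := by
  induction w with
  | nil => simp at hx
  | cons a l ih =>
    rcases List.mem_cons.mp hx with rfl | h
    · exact le_max_left _ _
    · exact (ih h).trans (le_max_right _ _)

lemma foldr_max_eq {w : List ℕ} {n : ℕ} (hn : n ∈ w) (h : ∀ x ∈ w, x ≤ n) :
    w.foldr max 0 = n :=
  le_antisymm (h _ (foldr_max_mem (List.ne_nil_of_mem hn))) (le_foldr_max hn)

lemma blocks_of_not_mem {n : ℕ} {w : List ℕ} (h : n ∉ w) : blocks n w = [w] := by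
  induction w with
  | nil => rfl
  | cons a l ih =>
    simp only [List.mem_cons, not_or] at h
    simp [blocks, Ne.symm h.1, ih h.2]

lemma blocks_append_cons {n : ℕ} (L : List ℕ) {R : List ℕ} (h : n ∉ R) :
    blocks n (L ++ n :: R) = blocks n L ++ [R] := by
  induction L with
  | nil => simp [blocks, blocks_of_not_mem h]
  | cons a l ih =>
    obtain ⟨b, t, hbt⟩ := List.exists_cons_of_ne_nil (blocks_ne_nil n l)
    by_cases ha : a = n <;> simp [blocks, ha, ih, hbt]

lemma slow_nil : slow [] = [] := by
  rw [slow]; simp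

lemma slow_eq_of_le {n : ℕ} {w : List ℕ} (h : ∀ x ∈ w, x ≤ n) :
    slow w = slow (blocks n w).headI ++
      ((blocks n w).tail.map fun A => slow A ++ [n]).flatten := by
  by_cases hn : n ∈ w
  · rw [slow, dif_neg (List.ne_nil_of_mem hn)]
    simp only [foldr_max_eq hn h]
    rw [List.attach_map_val (f := fun A => slow A ++ [n]), foldr_max_eq hn h]
  · simp [blocks_of_not_mem hn]

lemma slow_append_cons {n : ℕ} {L R : List ℕ} (hL : ∀ x ∈ L, x ≤ n) (hR : ∀ x ∈ R, x < n) :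
    slow (L ++ n :: R) = slow L ++ slow R ++ [n] := by
  have hw : ∀ x ∈ L ++ n :: R, x ≤ n := by
    intro x hx
    simp only [List.mem_append, List.mem_cons] at hx
    rcases hx with hx | rfl | hx
    · exact hL x hx
    · exact le_rfl
    · exact (hR x hx).le
  rw [slow_eq_of_le hw, slow_eq_of_le hL, blocks_append_cons L fun h => (hR n h).false]
  obtain ⟨b, t, hbt⟩ := List.exists_cons_of_ne_nil (blocks_ne_nil n L)
  simp [hbt]

lemma westS_nil : westS [] = [] := by
  rw [westS]; simp

lemma westS_append_cons {m : ℕ} {L R : List ℕ} (hL : ∀ x ∈ L, x < m) (hR : ∀ x ∈ R, x ≤ m) :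
    westS (L ++ m :: R) = westS L ++ westS R ++ [m] := by
  have hmax : (L ++ m :: R).foldr max 0 = m := by
    refine foldr_max_eq (by simp) fun x hx => ?_
    simp only [List.mem_append, List.mem_cons] at hx
    rcases hx with hx | rfl | hx
    · exact (hL x hx).le
    · exact le_rfl
    · exact hR x hx
  have hidx : (L ++ m :: R).idxOf m = L.length := by
    rw [List.idxOf_append_of_notMem fun h => (hL m h).false]
    simp
  rw [westS, dif_neg (by simp)]
  simp only [hmax, hidx]
  simp [List.drop_append, List.drop_eq_nil_of_le]

/-- A list of labels is ascending on the fibres of `f` if labels with the same image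
under `f` appear in strictly increasing order. -/
def AscOnFibers (f : ℕ → ℕ) (l : List ℕ) : Prop :=
  l.Pairwise fun x y => f x = f y → x < y

/-- An induction principle for lists that are ascending on the fibres of `f`, following the
decomposition at the largest entry. -/
lemma AscOnFibers.max_induction {f : ℕ → ℕ} {p : List ℕ → Prop} (nil : p [])
    (step : ∀ (L R : List ℕ) (m : ℕ), (∀ x ∈ L, x < m) → (∀ x ∈ R, x < m) →
      AscOnFibers f (L ++ m :: R) → p L → p R → p (L ++ m :: R))
    (l : List ℕ) (hl : AscOnFibers f l) : p l := by
  induction hlen : l.length using Nat.strong_induction_on generalizing l with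
  | _ N ih =>
    subst hlen
    rcases eq_or_ne l [] with rfl | hne
    · exact nil
    obtain ⟨L, R, hLR⟩ := List.append_of_mem (foldr_max_mem hne)
    have hle : ∀ x ∈ l, x ≤ l.foldr max 0 := fun x hx => le_foldr_max hx
    generalize l.foldr max 0 = m at hLR hle
    subst hLR
    have h := hl
    simp only [AscOnFibers, List.pairwise_append, List.pairwise_cons] at h
    obtain ⟨h1, ⟨h2, h3⟩, h4⟩ := h
    refine step L R m (fun x hx => ?_) (fun x hx => ?_) hl
      (ih _ (by simp) L h1 rfl) (ih _ (by simp; omega) R h3 rfl)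
    · refine lt_of_le_of_ne (hle x (by simp [hx])) ?_
      rintro rfl
      exact (h4 x hx x (by simp) rfl).false
    · refine lt_of_le_of_ne (hle x (by simp [hx])) ?_
      rintro rfl
      exact (h2 x hx rfl).false

lemma AscOnFibers.westS_perm {f : ℕ → ℕ} {l : List ℕ} (hl : AscOnFibers f l) :
    (westS l).Perm l := by
  refine AscOnFibers.max_induction (p := fun l => (westS l).Perm l) ?_ ?_ l hl
  · rw [westS_nil]
  · intro L R m hL hR _ ihL ihR
    rw [westS_append_cons hL fun x hx => (hR x hx).le, List.append_assoc]
    exact ihL.append ((List.perm_append_singleton m _).trans (ihR.cons m))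

lemma AscOnFibers.westS {f : ℕ → ℕ} {l : List ℕ} (hl : AscOnFibers f l) :
    AscOnFibers f (westS l) := by
  refine AscOnFibers.max_induction (p := fun l => AscOnFibers f (_root_.westS l)) ?_ ?_ l hl
  · rw [westS_nil]
    exact List.Pairwise.nil
  · intro L R m hL hR h ihL ihR
    rw [westS_append_cons hL fun x hx => (hR x hx).le]
    simp only [AscOnFibers, List.pairwise_append, List.pairwise_cons] at h
    obtain ⟨h1, ⟨-, h3⟩, h4⟩ := h
    have hpL := AscOnFibers.westS_perm (f := f) h1
    have hpR := AscOnFibers.westS_perm (f := f) h3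
    simp only [AscOnFibers, List.pairwise_append]
    refine ⟨⟨ihL, ihR, fun x hx y hy => ?_⟩, List.pairwise_singleton _ _, fun x hx y hy _ => ?_⟩
    · exact h4 x (hpL.mem_iff.mp hx) y (List.mem_cons_of_mem _ (hpR.mem_iff.mp hy))
    · rw [List.mem_singleton.mp hy]
      rcases List.mem_append.mp hx with hx | hx
      · exact hL x (hpL.mem_iff.mp hx)
      · exact hR x (hpR.mem_iff.mp hx)

lemma AscOnFibers.slow_map {f : ℕ → ℕ} (hf : Monotone f) {l : List ℕ} (hl : AscOnFibers f l) :
    slow (l.map f) = (_root_.westS l).map f := by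
  refine AscOnFibers.max_induction
    (p := fun l => slow (l.map f) = (_root_.westS l).map f) ?_ ?_ l hl
  · simp [westS_nil, slow_nil]
  · intro L R m hL hR h ihL ihR
    rw [westS_append_cons hL fun x hx => (hR x hx).le, List.map_append, List.map_cons,
      slow_append_cons, ihL, ihR]
    · simp
    · simp only [List.mem_map]
      rintro _ ⟨x, hx, rfl⟩
      exact hf (hL x hx).le
    · simp only [List.mem_map]
      rintro _ ⟨x, hx, rfl⟩
      refine lt_of_le_of_ne (hf (hR x hx).le) fun he => ?_
      simp only [AscOnFibers, List.pairwise_append, List.pairwise_cons] at h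
      exact (h.2.1.1 x hx he.symm).asymm (hR x hx)

lemma AscOnFibers.slow_iterate_map {f : ℕ → ℕ} (hf : Monotone f) (k : ℕ) {l : List ℕ}
    (hl : AscOnFibers f l) : slow^[k] (l.map f) = (_root_.westS^[k] l).map f := by
  induction k generalizing l with
  | zero => rfl
  | succ k ih => rw [Function.iterate_succ_apply, Function.iterate_succ_apply, hl.slow_map hf,
      ih hl.westS]

lemma psiLetter_monotone (c : List ℕ) : Monotone (psiLetter c) := by
  induction c with
  | nil => exact fun _ _ _ => le_rfl
  | cons a c ih =>
    intro u v huv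
    have := ih (Nat.sub_le_sub_right huv a)
    simp only [psiLetter]
    split_ifs <;> omega

lemma psiLetter_sum_take_add {c : List ℕ} {j r : ℕ} (hr : 0 < r) (hrc : r ≤ c.getD j 0) :
    psiLetter c ((c.take j).sum + r) = j + 1 := by
  induction c generalizing j with
  | nil => simp at hrc; omega
  | cons a c ih =>
    cases j with
    | zero =>
      have h : r ≤ a := by simpa using hrc
      simp [psiLetter, h]
    | succ j =>
      have h := ih (j := j) (by simpa using hrc)
      rw [List.take_succ_cons, List.sum_cons, psiLetter, if_neg (by omega), show a + (c.take j).sum + r - a = (c.take j).sum + r by omega, h]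

lemma psiLetter_phiAsc_entry {c w : List ℕ} (hw : InW c w) {t : ℕ} (ht : t < w.length) :
    psiLetter c ((c.take (w.getD t 0 - 1)).sum + (w.take (t + 1)).count (w.getD t 0)) =
      w.getD t 0 := by
  have hget : w.getD t 0 = w[t] := by simp [ht]
  have h0 : w[t] ≠ 0 := fun h => hw.1 (h ▸ List.getElem_mem ht)
  obtain ⟨i, hi⟩ := Nat.exists_eq_succ_of_ne_zero h0
  rw [hget, hi, Nat.succ_sub_one]
  refine psiLetter_sum_take_add (List.count_pos_iff.mpr ?_) ?_
  · rw [← hi, List.take_succ_eq_append_getElem ht]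
    exact List.mem_append_right _ (List.mem_singleton_self _)
  · rw [← hw.2 i]
    exact (List.take_sublist _ _).count_le _

lemma psiMap_phiAsc {c w : List ℕ} (hw : InW c w) : psiMap c (phiAsc c w) = w := by
  rw [psiMap, phiAsc, List.map_map]
  refine List.ext_getElem (by simp) fun t h1 h2 => ?_
  have := psiLetter_phiAsc_entry hw h2
  simpa [h2] using this

lemma ascOnFibers_phiAsc {c w : List ℕ} (hw : InW c w) :
    AscOnFibers (psiLetter c) (phiAsc c w) := by
  rw [AscOnFibers, phiAsc, List.pairwise_map]
  refine List.pairwise_lt_range.imp_of_mem fun {s t} hs ht hst he => ?_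
  rw [List.mem_range] at hs ht
  rw [psiLetter_phiAsc_entry hw hs, psiLetter_phiAsc_entry hw ht] at he
  have hle : (w.take (s + 1)).count (w.getD t 0) ≤ (w.take t).count (w.getD t 0) :=
    (List.take_sublist_take_left (by omega)).count_le _
  have hlt : (w.take t).count (w.getD t 0) < (w.take (t + 1)).count (w.getD t 0) := by
    rw [List.take_succ_eq_append_getElem ht, List.count_append,
      List.getD_eq_getElem _ _ ht, List.count_singleton_self]
    exact Nat.lt_succ_self _
  rw [he]
  omega


/-- For every tuple `c = (c₁, …, c_n)` of nonnegative integers, every word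
`w ∈ W_c`, and every positive integer `k`, one has `slow^k w = ψ_c (s^k (φ^asc_c w))`. -/
theorem slow_iterate_eq_psi_s_iterate_phiAsc (c : List ℕ) (w : List ℕ) (hw : InW c w)
    (k : ℕ) (hk : 1 ≤ k) :
    slow^[k] w = psiMap c (westS^[k] (phiAsc c w)) := by
 
  have h := (ascOnFibers_phiAsc hw).slow_iterate_map (psiLetter_monotone c) k
  rwa [← psiMap, psiMap_phiAsc hw] at h
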